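/- Consider the Hamilton–Jacobi equation u_t + H(x,∇u) = 0 in ℝⁿ × (0,T). Assume H ∈ UC(ℝⁿ × B_R(0)) for every R > 0 and that there exists a modulus of continuity m : [0,+∞) → [0,+∞) such that |H(x,p) − H(y,p)| ≤ m(|x−y|(1+|p|)) for all x, y, p ∈ ℝⁿ. Let u₁, u₂ ∈ UC(ℝⁿ × [0,T]) be respectively a viscosity subsolution and a viscosity supersolution of the equation. Then sup_{(x,t) ∈ ℝⁿ × (0,T)} (u₁(x,t) − u₂(x,t)) ≤ sup_{x ∈ ℝⁿ} (u₁(x,0) − u₂(x,0)). -/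

import Mathlib

open Filter Topology Set Metric

/-- `Euc n` is the Euclidean space `ℝⁿ`. -/
abbrev Euc (n : ℕ) := EuclideanSpace ℝ (Fin n)

/-- Viscosity subsolution of `u_t + F(x, ∇u) = 0` on `ℝⁿ × I` (time interval `I`),
for an upper semicontinuous `u` on `ℝⁿ × closure I`. -/
def IsParabolicSubsolution (n : ℕ) (F : Euc n → Euc n → ℝ) (I : Set ℝ)
    (u : Euc n → ℝ → ℝ) : Prop :=
  UpperSemicontinuousOn (fun p : Euc n × ℝ => u p.1 p.2) (Set.univ ×ˢ closure I) ∧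
  ∀ x₀ : Euc n, ∀ t₀ ∈ I, ∀ v : Euc n × ℝ → ℝ, ContDiff ℝ 1 v →
    IsLocalMax (fun p : Euc n × ℝ => u p.1 p.2 - v p) (x₀, t₀) →
    fderiv ℝ v (x₀, t₀) ((0 : Euc n), (1 : ℝ)) +
      F x₀ (gradient (fun y => v (y, t₀)) x₀) ≤ 0

/-- Viscosity supersolution of `u_t + F(x, ∇u) = 0` on `ℝⁿ × I`. -/
def IsParabolicSupersolution (n : ℕ) (F : Euc n → Euc n → ℝ) (I : Set ℝ)
    (u : Euc n → ℝ → ℝ) : Prop :=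
  LowerSemicontinuousOn (fun p : Euc n × ℝ => u p.1 p.2) (Set.univ ×ˢ closure I) ∧
  ∀ x₀ : Euc n, ∀ t₀ ∈ I, ∀ v : Euc n × ℝ → ℝ, ContDiff ℝ 1 v →
    IsLocalMin (fun p : Euc n × ℝ => u p.1 p.2 - v p) (x₀, t₀) →
    fderiv ℝ v (x₀, t₀) ((0 : Euc n), (1 : ℝ)) +
      F x₀ (gradient (fun y => v (y, t₀)) x₀) ≥ 0

/-- A uniformly continuous function on a convex set grows at most linearly, with an arbitrarily
small additive constant. -/
theorem UniformContinuousOn.exists_abs_sub_le_add_mul_dist {E : Type*} [NormedAddCommGroup E]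
    [NormedSpace ℝ E] {S : Set E} {f : E → ℝ} (hS : Convex ℝ S) (hf : UniformContinuousOn f S)
    {κ : ℝ} (hκ : 0 < κ) :
    ∃ L : ℝ, 0 ≤ L ∧ ∀ z ∈ S, ∀ w ∈ S, |f z - f w| ≤ κ + L * dist z w := by
  obtain ⟨δ, hδ, h⟩ := Metric.uniformContinuousOn_iff.1 hf κ hκ
  refine ⟨κ / δ, by positivity, fun z hz w hw => ?_⟩
  set N : ℕ := ⌊dist z w / δ⌋₊ + 1 with hN
  have hN0 : (0 : ℝ) < N := by rw [hN]; positivity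
  have hdN : dist z w < N * δ := by
    have := Nat.lt_floor_add_one (dist z w / δ)
    rw [div_lt_iff₀ hδ] at this
    simpa [hN] using this
  set g : ℕ → E := fun i => AffineMap.lineMap z w ((i : ℝ) / N) with hg
  have hmem : ∀ i ≤ N, g i ∈ S := fun i hi =>
    hS.lineMap_mem hz hw ⟨by positivity, by
      rw [div_le_one hN0]; exact_mod_cast hi⟩
  have hstep : ∀ i, dist (g i) (g (i + 1)) < δ := by
    intro i
    rw [hg]
    simp only [dist_lineMap_lineMap]
    have : dist ((i : ℝ) / N) (((i + 1 : ℕ) : ℝ) / N) = 1 / N := by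
      rw [Real.dist_eq, ← sub_div, abs_div, abs_of_pos hN0]
      simp
    rw [this, one_div, inv_mul_lt_iff₀ hN0]
    exact hdN
  have hsum := dist_le_range_sum_dist (fun i => f (g i)) N
  have hle : ∑ i ∈ Finset.range N, dist (f (g i)) (f (g (i + 1))) ≤ N * κ := by
    calc _ ≤ ∑ i ∈ Finset.range N, κ := Finset.sum_le_sum fun i hi => by
          have hi' := Finset.mem_range.1 hi
          exact (h _ (hmem i hi'.le) _ (hmem (i + 1) hi') (hstep i)).le
      _ = N * κ := by simp
  have h0 : g 0 = z := by simp [hg]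
  have h1 : g N = w := by simp [hg]
  rw [h0, h1, Real.dist_eq] at hsum
  have hfl : (⌊dist z w / δ⌋₊ : ℝ) ≤ dist z w / δ := Nat.floor_le (by positivity)
  calc |f z - f w| ≤ N * κ := hsum.trans hle
    _ = κ + ⌊dist z w / δ⌋₊ * κ := by rw [hN]; push_cast; ring
    _ ≤ κ + dist z w / δ * κ := by gcongr
    _ = κ + κ / δ * dist z w := by ring

/-- A space-time function on `ℝⁿ × [0,T]` which is uniformly continuous grows at most linearly,
with an arbitrarily small additive constant. -/
theorem UniformContinuousOn.exists_sub_le_add_mul {n : ℕ} {T : ℝ} {u : Euc n → ℝ → ℝ}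
    (hu : UniformContinuousOn (fun q : Euc n × ℝ => u q.1 q.2) (Set.univ ×ˢ Set.Icc 0 T))
    {κ : ℝ} (hκ : 0 < κ) :
    ∃ L : ℝ, 0 ≤ L ∧ ∀ x y : Euc n, ∀ t ∈ Set.Icc 0 T, ∀ s ∈ Set.Icc 0 T,
      u x t - u y s ≤ κ + L * (‖x - y‖ + |t - s|) := by
  obtain ⟨L, hL, h⟩ :=
    hu.exists_abs_sub_le_add_mul_dist (convex_univ.prod (convex_Icc 0 T)) hκ
  refine ⟨L, hL, fun x y t ht s hs => ?_⟩
  have h1 := (le_abs_self _).trans (h (x, t) ⟨mem_univ _, ht⟩ (y, s) ⟨mem_univ _, hs⟩)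
  refine h1.trans ?_
  gcongr
  rw [Prod.dist_eq, dist_eq_norm, Real.dist_eq]
  exact max_le (le_add_of_nonneg_right (abs_nonneg _)) (le_add_of_nonneg_left (norm_nonneg _))

/-- The test function of the doubling of variables argument: quadratic penalizations around
`(y, s)` and `z`, and an exponential barrier in time. -/
noncomputable def doublingTest {n : ℕ} (c α a K T₁ : ℝ) (y z : Euc n) (s : ℝ) (q : Euc n × ℝ) : ℝ :=
  c * ‖q.1 - y‖ ^ 2 + c * (q.2 - s) ^ 2 + α * ‖q.1 - z‖ ^ 2 + a * Real.exp (K * (q.2 - T₁))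

theorem contDiff_doublingTest {n : ℕ} (c α a K T₁ : ℝ) (y z : Euc n) (s : ℝ) :
    ContDiff ℝ 1 (doublingTest c α a K T₁ y z s) := by
  unfold doublingTest
  have h1 : ContDiff ℝ 1 fun q : Euc n × ℝ => ‖q.1 - y‖ ^ 2 :=
    (contDiff_fst.sub contDiff_const).norm_sq ℝ
  have h2 : ContDiff ℝ 1 fun q : Euc n × ℝ => ‖q.1 - z‖ ^ 2 :=
    (contDiff_fst.sub contDiff_const).norm_sq ℝ
  fun_prop

theorem fderiv_doublingTest_time {n : ℕ} (c α a K T₁ : ℝ) (y z : Euc n) (s : ℝ)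
    (x₀ : Euc n) (t₀ : ℝ) :
    fderiv ℝ (doublingTest c α a K T₁ y z s) (x₀, t₀) ((0 : Euc n), (1 : ℝ)) =
      2 * c * (t₀ - s) + a * K * Real.exp (K * (t₀ - T₁)) := by
  have hd : HasFDerivAt (doublingTest c α a K T₁ y z s)
      (fderiv ℝ (doublingTest c α a K T₁ y z s) (x₀, t₀)) (x₀, t₀) :=
    ((contDiff_doublingTest c α a K T₁ y z s).differentiable one_ne_zero _).hasFDerivAt
  have hl : HasDerivAt (fun t : ℝ => (x₀, t)) ((0 : Euc n), (1 : ℝ)) t₀ :=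
    (hasDerivAt_const t₀ x₀).prodMk (hasDerivAt_id t₀)
  have h1 := hd.comp_hasDerivAt t₀ hl
  have h2 : HasDerivAt (fun t : ℝ => c * ‖x₀ - y‖ ^ 2 + c * (t - s) ^ 2 + α * ‖x₀ - z‖ ^ 2 +
      a * Real.exp (K * (t - T₁)))
      (2 * c * (t₀ - s) + a * K * Real.exp (K * (t₀ - T₁))) t₀ := by
    have e1 : HasDerivAt (fun t : ℝ => t - s) 1 t₀ := (hasDerivAt_id t₀).sub_const s
    have e2 : HasDerivAt (fun t : ℝ => K * (t - T₁)) (K * 1) t₀ :=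
      ((hasDerivAt_id t₀).sub_const T₁).const_mul K
    have e3 := ((((e1.pow 2).const_mul c).const_add (c * ‖x₀ - y‖ ^ 2)).add_const
      (α * ‖x₀ - z‖ ^ 2)).add (e2.exp.const_mul a)
    refine e3.congr_deriv ?_
    simp only [Nat.cast_ofNat, Nat.add_one_sub_one, pow_one]
    ring
  exact h1.unique h2

theorem gradient_doublingTest_space {n : ℕ} (c α a K T₁ : ℝ) (y z : Euc n) (s : ℝ)
    (x₀ : Euc n) (t₀ : ℝ) :
    gradient (fun x => doublingTest c α a K T₁ y z s (x, t₀)) x₀ =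
      (2 * c) • (x₀ - y) + (2 * α) • (x₀ - z) := by
  apply HasGradientAt.gradient
  rw [hasGradientAt_iff_hasFDerivAt]
  have e : ∀ w : Euc n, HasFDerivAt (fun x : Euc n => ‖x - w‖ ^ 2)
      (2 • (innerSL ℝ (x₀ - w)).comp (ContinuousLinearMap.id ℝ (Euc n))) x₀ :=
    fun w => ((hasFDerivAt_id x₀).sub_const w).norm_sq
  have h := ((((e y).const_mul c).add_const (c * (t₀ - s) ^ 2)).add
    ((e z).const_mul α)).add_const (a * Real.exp (K * (t₀ - T₁)))
  refine h.congr_fderiv ?_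
  ext v
  simp
  ring

/-- At an interior maximum of the doubled functional, the two viscosity inequalities combine. -/
theorem doubling_viscosity_inequality {n : ℕ} {T : ℝ} {Ham : Euc n → Euc n → ℝ}
    {u₁ u₂ : Euc n → ℝ → ℝ}
    (hu₁ : IsParabolicSubsolution n Ham (Set.Ioo 0 T) u₁)
    (hu₂ : IsParabolicSupersolution n Ham (Set.Ioo 0 T) u₂)
    {c α a K T₁ : ℝ} {z x₀ y₀ : Euc n} {t₀ s₀ : ℝ}
    (ht₀ : t₀ ∈ Set.Ioo 0 T) (hs₀ : s₀ ∈ Set.Ioo 0 T)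
    (hmax : ∀ x y : Euc n, ∀ t ∈ Set.Icc 0 T, ∀ s ∈ Set.Icc 0 T,
      u₁ x t - u₂ y s - doublingTest c α a K T₁ y z s (x, t) - a * Real.exp (K * (s - T₁)) ≤
      u₁ x₀ t₀ - u₂ y₀ s₀ - doublingTest c α a K T₁ y₀ z s₀ (x₀, t₀)
        - a * Real.exp (K * (s₀ - T₁))) :
    a * K * Real.exp (K * (t₀ - T₁)) + a * K * Real.exp (K * (s₀ - T₁)) ≤
      Ham y₀ ((2 * c) • (x₀ - y₀)) - Ham x₀ ((2 * c) • (x₀ - y₀) + (2 * α) • (x₀ - z)) := by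
  have hev : ∀ {r : ℝ} (w : Euc n), r ∈ Set.Ioo 0 T →
      ∀ᶠ q : Euc n × ℝ in 𝓝 (w, r), q.2 ∈ Set.Icc 0 T := fun w hr =>
    continuous_snd.continuousAt.eventually
      (Icc_mem_nhds hr.1 hr.2)
  have h1 := hu₁.2 x₀ t₀ ht₀ _ (contDiff_doublingTest c α a K T₁ y₀ z s₀) (by
    filter_upwards [hev x₀ ht₀] with q hq
    have := hmax q.1 y₀ q.2 hq s₀ ⟨hs₀.1.le, hs₀.2.le⟩
    linarith)
  have h2 := hu₂.2 y₀ s₀ hs₀ _ (contDiff_doublingTest (-c) 0 (-a) K T₁ x₀ z t₀) (by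
    filter_upwards [hev y₀ hs₀] with q hq
    have := hmax x₀ q.1 t₀ ⟨ht₀.1.le, ht₀.2.le⟩ q.2 hq
    simp only [doublingTest] at this ⊢
    rw [norm_sub_rev x₀ q.1, norm_sub_rev x₀ y₀] at this
    linarith)
  rw [fderiv_doublingTest_time, gradient_doublingTest_space] at h1 h2
  have e : (2 * -c) • (y₀ - x₀) + (2 * (0 : ℝ)) • (y₀ - z) = (2 * c) • (x₀ - y₀) := by
    module
  rw [e] at h2
  linarith

/-- The doubled functional attains its maximum over `ℝⁿ × ℝⁿ × [0,T] × [0,T]` as soon as it is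
dominated by a coercive quadratic. -/
theorem exists_max_doubling {n : ℕ} {T : ℝ} {u₁ u₂ : Euc n → ℝ → ℝ}
    (hu₁ : ContinuousOn (fun q : Euc n × ℝ => u₁ q.1 q.2) (Set.univ ×ˢ Set.Icc 0 T))
    (hu₂ : ContinuousOn (fun q : Euc n × ℝ => u₂ q.1 q.2) (Set.univ ×ˢ Set.Icc 0 T))
    {c α a K T₁ D : ℝ} (hc : 0 < c) (hα : 0 < α) (ha : 0 ≤ a) (hT₁ : T₁ ∈ Set.Icc 0 T) (z : Euc n)
    (hD : ∀ x y : Euc n, ∀ t ∈ Set.Icc 0 T, ∀ s ∈ Set.Icc 0 T,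
      u₁ x t - u₂ y s ≤ D + c / 2 * ‖x - y‖ ^ 2 + c * (t - s) ^ 2) :
    ∃ x₀ y₀ : Euc n, ∃ t₀ ∈ Set.Icc 0 T, ∃ s₀ ∈ Set.Icc 0 T,
      ∀ x y : Euc n, ∀ t ∈ Set.Icc 0 T, ∀ s ∈ Set.Icc 0 T,
      u₁ x t - u₂ y s - doublingTest c α a K T₁ y z s (x, t) - a * Real.exp (K * (s - T₁)) ≤
      u₁ x₀ t₀ - u₂ y₀ s₀ - doublingTest c α a K T₁ y₀ z s₀ (x₀, t₀)
        - a * Real.exp (K * (s₀ - T₁)) := by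
  set Φ : Euc n × Euc n × ℝ × ℝ → ℝ := fun q =>
    u₁ q.1 q.2.2.1 - u₂ q.2.1 q.2.2.2
      - doublingTest c α a K T₁ q.2.1 z q.2.2.2 (q.1, q.2.2.1)
      - a * Real.exp (K * (q.2.2.2 - T₁)) with hΦ
  set P : ℝ := Φ (z, z, T₁, T₁) with hP
  obtain ⟨R, hR0, hR1, hR2⟩ : ∃ R : ℝ, 0 < R ∧ D - P < c / 2 * R ^ 2 ∧ D - P < α * R ^ 2 := by
    have hR : Tendsto (fun R : ℝ => R ^ 2) atTop atTop := tendsto_pow_atTop two_ne_zero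
    exact ((eventually_gt_atTop 0).and (((hR.const_mul_atTop (half_pos hc)).eventually_gt_atTop
      (D - P)).and ((hR.const_mul_atTop hα).eventually_gt_atTop (D - P)))).exists
  set C : Set (Euc n × Euc n × ℝ × ℝ) :=
    closedBall z R ×ˢ closedBall z (2 * R) ×ˢ Set.Icc 0 T ×ˢ Set.Icc 0 T with hC
  have hCc : IsCompact C := (isCompact_closedBall _ _).prod ((isCompact_closedBall _ _).prod
    (isCompact_Icc.prod isCompact_Icc))
  have hzC : (z, z, T₁, T₁) ∈ C :=
    ⟨mem_closedBall_self hR0.le, mem_closedBall_self (by positivity), hT₁, hT₁⟩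
  have hcont : ContinuousOn Φ C := by
    have c1 : ContinuousOn (fun q : Euc n × Euc n × ℝ × ℝ => u₁ q.1 q.2.2.1) C :=
      hu₁.comp (f := fun q : Euc n × Euc n × ℝ × ℝ => (q.1, q.2.2.1))
        (by fun_prop) fun q hq => ⟨mem_univ _, hq.2.2.1⟩
    have c2 : ContinuousOn (fun q : Euc n × Euc n × ℝ × ℝ => u₂ q.2.1 q.2.2.2) C :=
      hu₂.comp (f := fun q : Euc n × Euc n × ℝ × ℝ => (q.2.1, q.2.2.2))
        (by fun_prop) fun q hq => ⟨mem_univ _, hq.2.2.2⟩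
    have c3 : Continuous fun q : Euc n × Euc n × ℝ × ℝ =>
        doublingTest c α a K T₁ q.2.1 z q.2.2.2 (q.1, q.2.2.1) := by
      unfold doublingTest
      fun_prop
    have c4 : Continuous fun q : Euc n × Euc n × ℝ × ℝ =>
        a * Real.exp (K * (q.2.2.2 - T₁)) := by
      fun_prop
    exact ((c1.sub c2).sub c3.continuousOn).sub c4.continuousOn
  obtain ⟨⟨x₀, y₀, t₀, s₀⟩, hq₀, hmax⟩ := hCc.exists_isMaxOn ⟨_, hzC⟩ hcont
  refine ⟨x₀, y₀, t₀, hq₀.2.2.1, s₀, hq₀.2.2.2, fun x y t ht s hs => ?_⟩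
  by_cases hq : (x, y, t, s) ∈ C
  · exact hmax hq
  · have hle : P ≤ Φ (x₀, y₀, t₀, s₀) := hmax hzC
    refine le_trans ?_ hle
    have hDx := hD x y t ht s hs
    have e1 : 0 ≤ a * Real.exp (K * (t - T₁)) := by positivity
    have e2 : 0 ≤ a * Real.exp (K * (s - T₁)) := by positivity
    have e3 : 0 ≤ c / 2 * ‖x - y‖ ^ 2 := by positivity
    have e4 : 0 ≤ α * ‖x - z‖ ^ 2 := by positivity
    simp only [doublingTest]
    by_cases hx : ‖x - z‖ ≤ R
    · have hxy : R < ‖x - y‖ := by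
        by_contra! hcon
        refine hq ⟨mem_closedBall_iff_norm.2 hx, mem_closedBall_iff_norm.2 ?_, ht, hs⟩
        have := norm_sub_le_norm_sub_add_norm_sub y x z
        rw [norm_sub_rev y x] at this
        linarith
      have : c / 2 * R ^ 2 ≤ c / 2 * ‖x - y‖ ^ 2 := by gcongr
      linarith
    · have : α * R ^ 2 ≤ α * ‖x - z‖ ^ 2 := by
        have := (not_le.1 hx).le
        gcongr
      linarith

/-- **Comparison principle** (Theorem 2.2 of the paper). Consider
`u_t + H(x, ∇u) = 0` in `ℝⁿ × (0,T)`, with `H ∈ UC(ℝⁿ × B_R(0))` for every `R > 0`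
and admitting a modulus of continuity `m` with
`|H(x,p) − H(y,p)| ≤ m(|x−y|(1+|p|))`. If `u₁, u₂ ∈ UC(ℝⁿ × [0,T])` are respectively a
viscosity sub- and supersolution, then
`sup_{ℝⁿ×(0,T)} (u₁ − u₂) ≤ sup_{ℝⁿ} (u₁(·,0) − u₂(·,0))`. -/
theorem comparison_principle
    (n : ℕ) (T : ℝ) (hT : 0 < T)
    (Ham : Euc n → Euc n → ℝ)
    (hHam_uc : ∀ R > (0 : ℝ),
      UniformContinuousOn (fun q : Euc n × Euc n => Ham q.1 q.2)
        (Set.univ ×ˢ Metric.ball (0 : Euc n) R))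
    (m : ℝ → ℝ) (hm0 : m 0 = 0) (hmc : ContinuousAt m 0) (hm_nonneg : ∀ s, 0 ≤ m s)
    (hHam_mod : ∀ x y p : Euc n, |Ham x p - Ham y p| ≤ m (‖x - y‖ * (1 + ‖p‖)))
    (u₁ u₂ : Euc n → ℝ → ℝ)
    (hu₁uc : UniformContinuousOn (fun q : Euc n × ℝ => u₁ q.1 q.2)
      (Set.univ ×ˢ Set.Icc 0 T))
    (hu₂uc : UniformContinuousOn (fun q : Euc n × ℝ => u₂ q.1 q.2)
      (Set.univ ×ˢ Set.Icc 0 T))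
    (hu₁ : IsParabolicSubsolution n Ham (Set.Ioo 0 T) u₁)
    (hu₂ : IsParabolicSupersolution n Ham (Set.Ioo 0 T) u₂) :
    ∀ M : ℝ, (∀ x : Euc n, u₁ x 0 - u₂ x 0 ≤ M) →
      ∀ x : Euc n, ∀ t ∈ Set.Ioo 0 T, u₁ x t - u₂ x t ≤ M := by
  intro M hM x₁ T₁ hT₁
  by_contra! hcon
  have hT₁' : T₁ ∈ Set.Icc 0 T := ⟨hT₁.1.le, hT₁.2.le⟩
  obtain ⟨θ, hθ⟩ : ∃ θ, θ = u₁ x₁ T₁ - u₂ x₁ T₁ - M := ⟨_, rfl⟩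
  have hθ0 : 0 < θ := by linarith
  -- an upper bound of `u₁ - u₂`
  obtain ⟨B, hB0, hB⟩ : ∃ B : ℝ, 0 < B ∧ ∀ x : Euc n, ∀ t ∈ Set.Icc 0 T,
      u₁ x t - u₂ x t ≤ M + B := by
    obtain ⟨L₁, hL₁, h₁⟩ := hu₁uc.exists_sub_le_add_mul one_pos
    obtain ⟨L₂, hL₂, h₂⟩ := hu₂uc.exists_sub_le_add_mul one_pos
    refine ⟨2 + (L₁ + L₂) * T, by positivity, fun x t ht => ?_⟩
    have h0 : (0 : ℝ) ∈ Set.Icc 0 T := ⟨le_rfl, hT.le⟩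
    have a1 := h₁ x x t ht 0 h0
    have a2 := h₂ x x 0 h0 t ht
    have a3 := hM x
    simp only [sub_self, norm_zero, zero_add, sub_zero, zero_sub, abs_neg,
      abs_of_nonneg ht.1] at a1 a2
    have a4 : L₁ * t ≤ L₁ * T := mul_le_mul_of_nonneg_left ht.2 hL₁
    have a5 : L₂ * t ≤ L₂ * T := mul_le_mul_of_nonneg_left ht.2 hL₂
    linarith
  -- the exponential barrier, small at `T₁` and large at `T`
  obtain ⟨a, ha⟩ : ∃ a, a = θ / 4 := ⟨_, rfl⟩
  have ha0 : 0 < a := by linarith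
  obtain ⟨K, hK0, hK⟩ : ∃ K : ℝ, 0 < K ∧ B ≤ a * Real.exp (K * (T - T₁)) := by
    have : Tendsto (fun K : ℝ => a * Real.exp (K * (T - T₁))) atTop atTop :=
      (Real.tendsto_exp_atTop.comp
        (tendsto_id.atTop_mul_const (sub_pos.2 hT₁.2))).const_mul_atTop ha0
    exact ((eventually_gt_atTop 0).and (this.eventually_ge_atTop B)).exists
  obtain ⟨ν, hν⟩ : ∃ ν, ν = a * K * Real.exp (K * (0 - T₁)) := ⟨_, rfl⟩
  have hν0 : 0 < ν := by rw [hν]; positivity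
  have hνle : ∀ t : ℝ, 0 ≤ t → ν ≤ a * K * Real.exp (K * (t - T₁)) := fun t ht => by
    rw [hν]; gcongr
  obtain ⟨ρ, hρ0, hρ⟩ : ∃ ρ > 0, ∀ r : ℝ, 0 ≤ r → r < ρ → m r < ν := by
    obtain ⟨ρ, hρ0, hρ⟩ := Metric.continuousAt_iff.1 hmc ν hν0
    refine ⟨ρ, hρ0, fun r hr hrρ => ?_⟩
    have := hρ (x := r) (by rwa [Real.dist_eq, sub_zero, abs_of_nonneg hr])
    rw [hm0, Real.dist_eq, sub_zero] at this
    exact (le_abs_self _).trans_lt this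
  -- the penalization parameter `c`
  obtain ⟨κ, hκ0, hκθ, hκρ⟩ : ∃ κ : ℝ, 0 < κ ∧ κ ≤ θ / 8 ∧ 8 * κ < ρ :=
    ⟨min (θ / 8) (ρ / 9), by positivity, min_le_left _ _, by
      have := min_le_right (θ / 8) (ρ / 9)
      linarith⟩
  obtain ⟨L₁, hL₁, h₁⟩ := hu₁uc.exists_sub_le_add_mul hκ0
  obtain ⟨L₂, hL₂, h₂⟩ := hu₂uc.exists_sub_le_add_mul hκ0
  obtain ⟨c, hc0, hcL₁, hcL₂, hc1⟩ : ∃ c : ℝ, 0 < c ∧ L₁ ^ 2 ≤ c * κ ∧ L₂ ^ 2 ≤ c * κ ∧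
      1 ≤ c * κ := by
    refine ⟨(L₁ ^ 2 + L₂ ^ 2 + 1) / κ, by positivity, ?_, ?_, ?_⟩ <;>
      rw [div_mul_cancel₀ _ hκ0.ne'] <;> nlinarith [sq_nonneg L₁, sq_nonneg L₂]
  have young : ∀ L r : ℝ, L ^ 2 ≤ c * κ → L * r ≤ c / 2 * r ^ 2 + κ / 2 := fun L r hL => by
    have h : c * (L * r) ≤ c * (c / 2 * r ^ 2 + κ / 2) := by nlinarith [sq_nonneg (c * r - L)]
    exact le_of_mul_le_mul_left h hc0
  have g₁ : ∀ x y : Euc n, ∀ t ∈ Set.Icc 0 T, ∀ s ∈ Set.Icc 0 T,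
      u₁ x t - u₁ y s ≤ 2 * κ + c / 2 * ‖x - y‖ ^ 2 + c / 2 * (t - s) ^ 2 :=
    fun x y t ht s hs => by
      have := h₁ x y t ht s hs
      have b1 := young L₁ ‖x - y‖ hcL₁
      have b2 := young L₁ |t - s| hcL₁
      rw [sq_abs] at b2
      linarith
  have g₂ : ∀ x y : Euc n, ∀ t ∈ Set.Icc 0 T, ∀ s ∈ Set.Icc 0 T,
      u₂ x t - u₂ y s ≤ 2 * κ + c / 2 * ‖x - y‖ ^ 2 + c / 2 * (t - s) ^ 2 :=
    fun x y t ht s hs => by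
      have := h₂ x y t ht s hs
      have b1 := young L₂ ‖x - y‖ hcL₂
      have b2 := young L₂ |t - s| hcL₂
      rw [sq_abs] at b2
      linarith
  have hD : ∀ x y : Euc n, ∀ t ∈ Set.Icc 0 T, ∀ s ∈ Set.Icc 0 T,
      u₁ x t - u₂ y s ≤ (M + B + 2 * κ) + c / 2 * ‖x - y‖ ^ 2 + c * (t - s) ^ 2 :=
    fun x y t ht s hs => by
      have b1 := g₂ x y t ht s hs
      have b2 := hB x t ht
      have b3 : 0 ≤ c / 2 * (t - s) ^ 2 := by positivity
      linarith
  -- the penalization at infinity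
  obtain ⟨δ, hδ0, hδ1, hδ⟩ : ∃ δ > 0, δ ≤ 1 ∧ ∀ x p q : Euc n, ‖p‖ ≤ 4 * (c * κ) → ‖q‖ < δ →
      Ham x p - Ham x (p + q) < ν := by
    obtain ⟨δ, hδ0, hδ⟩ := Metric.uniformContinuousOn_iff.1
      (hHam_uc (4 * (c * κ) + 1) (by positivity)) ν hν0
    refine ⟨min δ 1, by positivity, min_le_right _ _, fun x p q hp hq => ?_⟩
    have hq1 := hq.trans_le (min_le_right _ _)
    have hpq := norm_add_le p q
    have := hδ (x, p) ⟨mem_univ _, mem_ball_zero_iff.2 (by linarith)⟩ (x, p + q)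
      ⟨mem_univ _, mem_ball_zero_iff.2 (by linarith)⟩
      (by simpa [Prod.dist_eq] using (lt_min_iff.1 hq).1)
    exact (le_abs_self _).trans_lt this
  obtain ⟨α, hα0, hα⟩ : ∃ α : ℝ, 0 < α ∧ 4 * α * (B + 2 * κ) < δ ^ 2 := by
    have hpos : 0 < B + 2 * κ := by positivity
    refine ⟨δ ^ 2 / (8 * (B + 2 * κ)), by positivity, ?_⟩
    have : 4 * (δ ^ 2 / (8 * (B + 2 * κ))) * (B + 2 * κ) = δ ^ 2 / 2 := by
      field_simp
      norm_num
    rw [this]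
    exact half_lt_self (by positivity)
  obtain ⟨x₀, y₀, t₀, ht₀, s₀, hs₀, hmax⟩ := exists_max_doubling hu₁uc.continuousOn
    hu₂uc.continuousOn (K := K) hc0 hα0 ha0.le hT₁' x₁ hD
  have hval := hmax x₁ x₁ T₁ hT₁' T₁ hT₁'
  have hdiag := hmax x₀ x₀ t₀ ht₀ s₀ hs₀
  simp only [doublingTest, sub_self, norm_zero, mul_zero, Real.exp_zero, mul_one, ne_eq,
    OfNat.ofNat_ne_zero, not_false_eq_true, zero_pow, zero_add, add_zero] at hval hdiag
  have et : 0 ≤ a * Real.exp (K * (t₀ - T₁)) := by positivity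
  have es : 0 ≤ a * Real.exp (K * (s₀ - T₁)) := by positivity
  have ex : 0 ≤ α * ‖x₀ - x₁‖ ^ 2 := by positivity
  have er : 0 ≤ c / 2 * ‖x₀ - y₀‖ ^ 2 := by positivity
  have eτ : 0 ≤ c / 2 * (t₀ - s₀) ^ 2 := by positivity
  have hg₁ := g₁ x₀ y₀ t₀ ht₀ s₀ hs₀
  have hg₂ := g₂ x₀ y₀ t₀ ht₀ s₀ hs₀
  have ht₀' : t₀ ∈ Set.Ioo 0 T := by
    refine ⟨lt_of_le_of_ne ht₀.1 ?_, lt_of_le_of_ne ht₀.2 ?_⟩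
    · intro h
      have h' := hM x₀
      rw [h] at h'
      linarith
    · intro h
      have h' := hB x₀ t₀ ht₀
      rw [← h] at hK
      linarith
  have hs₀' : s₀ ∈ Set.Ioo 0 T := by
    refine ⟨lt_of_le_of_ne hs₀.1 ?_, lt_of_le_of_ne hs₀.2 ?_⟩
    · intro h
      have h' := hM y₀
      rw [h] at h'
      linarith
    · intro h
      have h' := hB y₀ s₀ hs₀
      rw [← h] at hK
      linarith
  have hvisc := doubling_viscosity_inequality hu₁ hu₂ ht₀' hs₀' hmax
  have hνt := hνle t₀ ht₀.1
  have hνs := hνle s₀ hs₀.1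
  -- estimates at the maximum point
  have hcr : c * ‖x₀ - y₀‖ ^ 2 ≤ 3 * κ := by
    have b1 := h₂ x₀ y₀ s₀ hs₀ s₀ hs₀
    have b2 := young L₂ ‖x₀ - y₀‖ hcL₂
    simp only [sub_self, abs_zero, add_zero] at b1
    linarith
  have hr : ‖x₀ - y₀‖ ≤ 2 * κ := by
    refine abs_le_of_sq_le_sq' ?_ (by positivity) |>.2
    have b1 : ‖x₀ - y₀‖ ^ 2 ≤ (c * κ) * ‖x₀ - y₀‖ ^ 2 :=
      le_mul_of_one_le_left (by positivity) hc1
    have b2 : κ * (c * ‖x₀ - y₀‖ ^ 2) ≤ κ * (3 * κ) := by gcongr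
    linarith [sq_nonneg κ, show (2 * κ) ^ 2 = 4 * κ ^ 2 by ring,
      show κ * (3 * κ) = 3 * κ ^ 2 by ring,
      show κ * (c * ‖x₀ - y₀‖ ^ 2) = c * κ * ‖x₀ - y₀‖ ^ 2 by ring]
  have hp : ‖(2 * c) • (x₀ - y₀)‖ = 2 * c * ‖x₀ - y₀‖ := by
    rw [norm_smul, Real.norm_of_nonneg (by positivity)]
  have hp' : ‖(2 * c) • (x₀ - y₀)‖ ≤ 4 * (c * κ) := by
    rw [hp]
    have b1 : 2 * c * ‖x₀ - y₀‖ ≤ 2 * c * (2 * κ) := by gcongr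
    linarith
  have hq : ‖(2 * α) • (x₀ - x₁)‖ < δ := by
    rw [norm_smul, Real.norm_of_nonneg (by positivity)]
    refine lt_of_pow_lt_pow_left₀ 2 hδ0.le ?_
    have b1 : α * ‖x₀ - x₁‖ ^ 2 ≤ B + 2 * κ := by
      have := hB x₀ t₀ ht₀
      linarith
    have b2 : 4 * α * (α * ‖x₀ - x₁‖ ^ 2) ≤ 4 * α * (B + 2 * κ) := by gcongr
    linarith
  have hH₁ := hδ x₀ _ _ hp' hq
  have hH₂ := (le_abs_self _).trans (hHam_mod y₀ x₀ ((2 * c) • (x₀ - y₀)))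
  rw [hp, norm_sub_rev y₀ x₀] at hH₂
  have hm := hρ (‖x₀ - y₀‖ * (1 + 2 * c * ‖x₀ - y₀‖)) (by positivity) (by linarith)
  linarith
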